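/- The number of spanning trees of the complete bipartite graph K_{p,q} (p, q ≥ 1) equals p^{q-1} · q^{p-1}. -/

import Mathlib

/-- `f` is a parent function for a spanning tree of `G` rooted at `r`: each vertex other than `r`
is sent to a neighbour, and iterating `f` leads to `r`. -/
def SimpleGraph.IsParentFunction {V : Type*} (G : SimpleGraph V) (r : V) (f : V → V) : Prop :=
  f r = r ∧ (∀ v ≠ r, G.Adj v (f v)) ∧ ∃ h : V → ℕ, ∀ v ≠ r, h (f v) < h v

/-- The graph joining each `v` with `f v`. -/
def SimpleGraph.ofFunction {V : Type*} (f : V → V) : SimpleGraph V :=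
  SimpleGraph.fromRel fun v w => f v = w

namespace SimpleGraph

variable {V : Type*} {G : SimpleGraph V} {r : V} {f g : V → V}

lemma ofFunction_adj {v w : V} : (ofFunction f).Adj v w ↔ v ≠ w ∧ (f v = w ∨ f w = v) :=
  fromRel_adj _ _ _

lemma IsParentFunction.ofFunction_le (hf : G.IsParentFunction r f) : ofFunction f ≤ G := by
  have key : ∀ v, v ≠ f v → G.Adj v (f v) := fun v hv =>
    hf.2.1 v fun h => hv (by rw [h, hf.1])
  intro v w hvw
  obtain ⟨hne, rfl | rfl⟩ := ofFunction_adj.1 hvw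
  · exact key v hne
  · exact (key w hne.symm).symm

lemma connected_ofFunction (h : V → ℕ) (hh : ∀ v ≠ r, h (f v) < h v) :
    (ofFunction f).Connected := by
  have reach : ∀ n v, h v = n → (ofFunction f).Reachable v r := by
    intro n
    induction n using Nat.strong_induction_on with
    | _ n ih =>
      rintro v rfl
      by_cases hv : v = r
      · rw [hv]
      · have hlt := hh v hv
        have hadj : (ofFunction f).Adj v (f v) :=
          ofFunction_adj.2 ⟨fun he => by rw [← he] at hlt; exact hlt.false, Or.inl rfl⟩
        exact hadj.reachable.trans (ih _ hlt _ rfl)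
  have : Nonempty V := ⟨r⟩
  exact ⟨fun v w => (reach _ v rfl).trans (reach _ w rfl).symm⟩

lemma IsParentFunction.isTree_ofFunction [Finite V] (hf : G.IsParentFunction r f) :
    (ofFunction f).IsTree := by
  obtain ⟨hr, -, h, hh⟩ := hf
  have hconn := connected_ofFunction h hh
  refine isTree_iff_connected_and_card.2 ⟨hconn, ?_⟩
  refine le_antisymm ?_ hconn.card_vert_le_card_edgeSet_add_one
  have hsub : (ofFunction f).edgeSet ⊆ (fun v => s(v, f v)) '' {r}ᶜ := by
    intro e
    induction e using Sym2.ind with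
    | _ v w =>
      rw [mem_edgeSet, ofFunction_adj]
      rintro ⟨hne, rfl | rfl⟩
      · exact ⟨v, fun hv => hne (by rw [Set.mem_singleton_iff.1 hv, hr]), rfl⟩
      · exact ⟨w, fun hw => hne (by rw [Set.mem_singleton_iff.1 hw, hr]), Sym2.eq_swap⟩
  have h₁ : (ofFunction f).edgeSet.ncard ≤ ({r}ᶜ : Set V).ncard :=
    (Set.ncard_le_ncard hsub (Set.toFinite _)).trans (Set.ncard_image_le (Set.toFinite _))
  have h₂ := Set.ncard_add_ncard_compl ({r} : Set V)
  rw [Set.ncard_singleton] at h₂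
  rw [Nat.card_coe_set_eq]
  lia

lemma IsParentFunction.eq_of_ofFunction_eq (hf : G.IsParentFunction r f)
    (hg : G.IsParentFunction r g) (hfg : ofFunction f = ofFunction g) : f = g := by
  obtain ⟨hfr, hfG, h, hh⟩ := hf
  have key : ∀ n v, h v = n → v ≠ r → f v = g v := by
    intro n
    induction n using Nat.strong_induction_on with
    | _ n ih =>
      rintro v rfl hv
      have hadj : (ofFunction g).Adj v (f v) := by
        rw [← hfg, ofFunction_adj]
        exact ⟨(hfG v hv).ne, Or.inl rfl⟩
      obtain ⟨-, he | he⟩ := ofFunction_adj.1 hadj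
      · exact he.symm
      · exfalso
        by_cases hr : f v = r
        · rw [hr, hg.1] at he
          exact hv he.symm
        · have h₁ := hh v hv
          have h₂ := hh _ hr
          rw [ih _ h₁ _ rfl hr, he] at h₂
          exact h₁.not_gt h₂
  funext v
  by_cases hv : v = r
  · rw [hv, hfr, hg.1]
  · exact key _ v rfl hv

lemma Connected.exists_adj_dist_lt (hG : G.Connected) {v : V} (hv : v ≠ r) :
    ∃ w, G.Adj v w ∧ G.dist w r < G.dist v r := by
  obtain ⟨p, hp⟩ := hG.exists_walk_length_eq_dist v r
  cases p with
  | nil => exact absurd rfl hv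
  | cons hadj p =>
    refine ⟨_, hadj, ?_⟩
    rw [← hp, Walk.length_cons]
    exact Nat.lt_succ_of_le (dist_le p)

lemma IsTree.exists_isParentFunction {T : SimpleGraph V} (hT : T.IsTree) (hTG : T ≤ G) (r : V) :
    ∃ f, G.IsParentFunction r f ∧ ofFunction f = T := by
  classical
  choose! p hp using fun v (hv : v ≠ r) => hT.connected.exists_adj_dist_lt hv
  let f : V → V := fun v => if v = r then r else p v
  have hfp : ∀ v ≠ r, f v = p v := fun v hv => if_neg hv
  have hlt : ∀ v ≠ r, T.dist (f v) r < T.dist v r := fun v hv => by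
    rw [hfp v hv]; exact (hp v hv).2
  have hf : T.IsParentFunction r f :=
    ⟨if_pos rfl, fun v hv => by rw [hfp v hv]; exact (hp v hv).1, fun v => T.dist v r, hlt⟩
  refine ⟨f, ⟨hf.1, fun v hv => hTG (hf.2.1 v hv), hf.2.2⟩, ?_⟩
  exact le_antisymm hf.ofFunction_le
    ((isTree_iff_minimal_connected.1 hT).2 (connected_ofFunction (T.dist · r) hlt) hf.ofFunction_le)

theorem card_spanningTrees_eq_card_parentFunctions [Finite V] (G : SimpleGraph V) (r : V) :
    Nat.card {T : SimpleGraph V // T ≤ G ∧ T.IsTree} = Nat.card {f // G.IsParentFunction r f} := by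
  symm
  refine Nat.card_eq_of_bijective
    (fun f => ⟨ofFunction f.1, f.2.ofFunction_le, f.2.isTree_ofFunction⟩) ⟨?_, ?_⟩
  · intro f g hfg
    exact Subtype.ext (f.2.eq_of_ofFunction_eq g.2 (congrArg Subtype.val hfg))
  · rintro ⟨T, hTG, hT⟩
    obtain ⟨f, hf, hfT⟩ := hT.exists_isParentFunction hTG r
    exact ⟨⟨f, hf⟩, Subtype.ext hfT⟩

end SimpleGraph

/-- The functions `a` and `b` are the parent functions of a forest on `A`, `B` and roots `R`. -/
def IsBipartiteForest {A B R : Type*} (a : A → B) (b : B → A ⊕ R) : Prop :=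
  ∃ (h : A → ℕ) (k : B → ℕ), (∀ x, k (a x) < h x) ∧ ∀ y x, b y = .inl x → h x < k y

/-- Forests with parts `A ⊕ R` and `B`, one tree rooted at each element of `R`. -/
abbrev BipartiteForest (A B R : Type*) : Type _ :=
  {ab : (A → B) × (B → A ⊕ R) // IsBipartiteForest ab.1 ab.2}

namespace BipartiteForest

variable {A B R : Type*}

lemma isEmpty_of_isEmpty [IsEmpty R] [Nonempty B] : IsEmpty (BipartiteForest A B R) := by
  refine ⟨fun ⟨⟨a, b⟩, h, k, ha, hb⟩ => ?_⟩
  obtain ⟨_, ⟨y, rfl⟩, hmin⟩ :=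
    exists_minimal_of_wellFoundedLT (· ∈ Set.range k) (Set.range_nonempty k)
  rcases hby : b y with x | z
  · have h₁ := hb y x hby
    have h₂ := ha x
    have := hmin ⟨a x, rfl⟩ (h₂.trans h₁).le
    lia
  · exact isEmptyElim z

lemma card_of_isEmpty_left [IsEmpty A] [Finite B] [Finite R] :
    Nat.card (BipartiteForest A B R) = Nat.card R ^ Nat.card B := by
  rw [← Nat.card_fun]
  symm
  refine Nat.card_eq_of_bijective
    (fun b => ⟨(isEmptyElim, fun y => .inr (b y)), fun _ => 0, fun _ => 0, isEmptyElim,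
      fun _ => isEmptyElim⟩) ⟨?_, ?_⟩
  · intro b c hbc
    funext y
    simpa using congrFun (congrArg (fun F => F.1.2) hbc) y
  · rintro ⟨⟨a, b⟩, h⟩
    refine ⟨fun y => (b y).elim isEmptyElim id, Subtype.ext (Prod.ext (Subsingleton.elim _ _) ?_)⟩
    funext y
    rcases hb : b y with x | z
    · exact isEmptyElim x
    · simp [hb]

/-- The elements of `B` whose parent is a root. -/
def rootChildren [Fintype B] (F : BipartiteForest A B R) : Finset B :=
  {y | (F.1.2 y).isRight}

/-- Deleting the roots of a forest leaves a forest rooted at the children of those roots. -/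
lemma card_rootChildren_eq [Fintype B] [DecidableEq B] [Finite A] [Finite R] (S : Finset B) :
    Nat.card {F : BipartiteForest A B R // F.rootChildren = S} =
      Nat.card (S → R) * Nat.card (BipartiteForest {y // y ∉ S} A S) := by
  rw [← Nat.card_prod]
  symm
  let a (G : BipartiteForest {y // y ∉ S} A S) (x : A) : B := (G.1.2 x).elim (↑) (↑)
  let b (g : S → R) (G : BipartiteForest {y // y ∉ S} A S) (y : B) : A ⊕ R :=
    if hy : y ∈ S then .inr (g ⟨y, hy⟩) else .inl (G.1.1 ⟨y, hy⟩)
  have hforest : ∀ g G, IsBipartiteForest (a G) (b g G) := by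
    rintro g ⟨⟨a', b'⟩, h, k, ha, hb⟩
    refine ⟨fun x => k x + 1, fun y => if hy : y ∈ S then 0 else h ⟨y, hy⟩ + 1, ?_, ?_⟩
    · intro x
      rcases hx : b' x with y | y
      · have := hb x y hx
        simp [a, hx, y.2, this]
      · simp [a, hx]
    · intro y x hyx
      by_cases hy : y ∈ S
      · simp [b, hy] at hyx
      · simp only [b, hy, dite_false, Sum.inl.injEq] at hyx
        have := ha ⟨y, hy⟩
        simp only [hy, dite_false]
        rw [← hyx]
        simpa using this
  refine Nat.card_eq_of_bijective
    (fun p => ⟨⟨(a p.2, b p.1 p.2), hforest p.1 p.2⟩, ?_⟩) ⟨?_, ?_⟩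
  · ext y
    by_cases hy : y ∈ S <;> simp [rootChildren, b, hy]
  · rintro ⟨g, G⟩ ⟨g', G'⟩ hp
    simp only [Subtype.mk.injEq, Prod.mk.injEq] at hp
    obtain ⟨ha, hb⟩ := hp
    refine Prod.ext ?_ (Subtype.ext (Prod.ext ?_ ?_))
    · funext y
      simpa [b] using congrFun hb y
    · funext y
      simpa [b, y.2] using congrFun hb y
    · funext x
      have hx := congrFun ha x
      simp only [a] at hx
      rcases h₁ : G.1.2 x with y | y <;> rcases h₂ : G'.1.2 x with z | z <;>
        simp only [h₁, h₂, Sum.elim_inl, Sum.elim_inr] at hx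
      · rw [Subtype.ext hx]
      · exact absurd (hx ▸ z.2) y.2
      · exact absurd (hx ▸ y.2) z.2
      · rw [Subtype.ext hx]
  · rintro ⟨⟨⟨c, d⟩, h, k, hc, hd⟩, hS⟩
    have hright : ∀ y : S, ∃ z, d y = .inr z := fun ⟨y, hy⟩ => by
      rw [← hS] at hy
      exact Sum.isRight_iff.1 (by simpa [rootChildren] using hy)
    have hleft : ∀ y : {y // y ∉ S}, ∃ x, d y = .inl x := fun ⟨y, hy⟩ => by
      rw [← hS] at hy
      exact Sum.isLeft_iff.1 (by simpa [rootChildren] using hy)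
    choose g hg using hright
    choose a' ha' using hleft
    let b' (x : A) : {y // y ∉ S} ⊕ S :=
      if hx : c x ∈ S then .inr ⟨c x, hx⟩ else .inl ⟨c x, hx⟩
    refine ⟨⟨g, ⟨(a', b'), fun y => k y, h, fun y => hd _ _ (ha' y), ?_⟩⟩, ?_⟩
    · intro x y hxy
      by_cases hx : c x ∈ S
      · simp [b', hx] at hxy
      · simp only [b', hx, dite_false, Sum.inl.injEq] at hxy
        rw [← hxy]
        exact hc x
    · refine Subtype.ext (Subtype.ext (Prod.ext ?_ ?_))
      · funext x
        by_cases hx : c x ∈ S <;> simp [a, b', hx]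
      · funext y
        by_cases hy : y ∈ S
        · simp [b, hy, ← hg ⟨y, hy⟩]
        · simp [b, hy, ← ha' ⟨y, hy⟩]

lemma card_eq_sum [Fintype B] [DecidableEq B] [Finite A] [Finite R] :
    Nat.card (BipartiteForest A B R) =
      ∑ S : Finset B, Nat.card (S → R) * Nat.card (BipartiteForest {y // y ∉ S} A S) := by
  rw [← Nat.card_congr (Equiv.sigmaFiberEquiv (rootChildren (A := A) (B := B) (R := R))),
    Nat.card_sigma]
  exact Finset.sum_congr rfl fun S _ => card_rootChildren_eq S

end BipartiteForest

lemma sum_powerset_mul_card_mul_pow (B : Type*) [Fintype B] [Nonempty B] (r a : ℕ) :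
    ∑ S : Finset B, S.card * r ^ S.card * a ^ (Fintype.card B - S.card) =
      Fintype.card B * r * (a + r) ^ (Fintype.card B - 1) := by
  rw [← Finset.powerset_univ,
    Finset.sum_powerset_apply_card (fun m => m * r ^ m * a ^ (Fintype.card B - m)),
    Finset.card_univ]
  obtain ⟨c, hc⟩ := Nat.exists_eq_succ_of_ne_zero (Fintype.card_ne_zero (α := B))
  rw [hc, Finset.sum_range_succ', add_comm a r, Nat.succ_sub_one, add_pow, Finset.mul_sum]
  simp only [zero_mul, smul_zero, add_zero]
  refine Finset.sum_congr rfl fun m _ => ?_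
  have hm : c.succ - (m + 1) = c - m := by lia
  have hch := Nat.add_one_mul_choose_eq c m
  rw [hm, smul_eq_mul, pow_succ]
  simp only [Nat.succ_eq_add_one]
  calc _ = ((c + 1).choose (m + 1) * (m + 1)) * (r ^ m * r * a ^ (c - m)) := by ring
    _ = _ := by rw [← hch]; push_cast; ring

theorem BipartiteForest.card_eq {A B R : Type} [Finite A] [Finite B] [Finite R] [Nonempty B] :
    Nat.card (BipartiteForest A B R) =
      Nat.card R * Nat.card B ^ Nat.card A * (Nat.card A + Nat.card R) ^ (Nat.card B - 1) := by
  induction hn : Nat.card A + Nat.card B using Nat.strong_induction_on generalizing A B R with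
  | _ n ih =>
    subst hn
    classical
    have := Fintype.ofFinite B
    rcases isEmpty_or_nonempty A with hA | hA
    · have hB : Nat.card B ≠ 0 := Nat.card_ne_zero.2 ⟨inferInstance, inferInstance⟩
      rw [card_of_isEmpty_left, Nat.card_of_isEmpty (α := A), pow_zero, mul_one, zero_add,
        mul_pow_sub_one hB]
    have key : ∀ S : Finset B, Nat.card (BipartiteForest {y // y ∉ S} A S) =
        S.card * Nat.card A ^ (Nat.card B - S.card) * Nat.card B ^ (Nat.card A - 1) := by
      intro S
      rcases S.eq_empty_or_nonempty with rfl | hS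
      · have := isEmpty_of_isEmpty (A := {y : B // y ∉ (∅ : Finset B)}) (B := A)
          (R := (∅ : Finset B))
        rw [Nat.card_of_isEmpty, Finset.card_empty, zero_mul, zero_mul]
      · have hc : Nat.card {y // y ∉ S} = Nat.card B - S.card := by
          simp [Fintype.card_subtype_compl]
        have hS₀ := hS.card_pos
        have hSB : S.card ≤ Nat.card B := by
          rw [Nat.card_eq_fintype_card]; exact S.card_le_univ
        rw [ih _ _ (A := {y // y ∉ S}) (B := A) (R := S) rfl, hc]
        · simp [Nat.sub_add_cancel (Nat.card_eq_fintype_card (α := B) ▸ hSB)]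
        · rw [hc]; lia
    rw [card_eq_sum]
    simp_rw [key, Nat.card_fun]
    have hsum := sum_powerset_mul_card_mul_pow B (Nat.card R) (Nat.card A)
    have hA₀ : Nat.card A ≠ 0 := Nat.card_ne_zero.2 ⟨inferInstance, inferInstance⟩
    rw [← Nat.card_eq_fintype_card] at hsum
    calc _ = Nat.card B ^ (Nat.card A - 1) * ∑ S : Finset B,
          S.card * Nat.card R ^ S.card * Nat.card A ^ (Nat.card B - S.card) := by
          rw [Finset.mul_sum]
          refine Finset.sum_congr rfl fun S _ => ?_
          rw [Nat.card_eq_fintype_card (α := S), Fintype.card_coe]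
          ring
      _ = _ := by
          rw [hsum, ← pow_sub_one_mul hA₀ (Nat.card B)]
          ring

lemma card_parentFunctions_completeBipartiteGraph (n q : ℕ) :
    Nat.card {f // (completeBipartiteGraph (Fin (n + 1)) (Fin q)).IsParentFunction (.inl 0) f} =
      Nat.card (BipartiteForest (Fin n) (Fin q) Unit) := by
  symm
  let F (ab : (Fin n → Fin q) × (Fin q → Fin n ⊕ Unit)) :
      Fin (n + 1) ⊕ Fin q → Fin (n + 1) ⊕ Fin q :=
    Sum.elim (Fin.cases (.inl 0) fun i => .inr (ab.1 i))
      fun j => .inl ((ab.2 j).elim Fin.succ fun _ => 0)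
  refine Nat.card_eq_of_bijective (fun p => ⟨F p.1, ?_⟩) ⟨?_, ?_⟩
  · obtain ⟨⟨a, b⟩, h, k, ha, hb⟩ := p
    refine ⟨rfl, ?_, Sum.elim (Fin.cases 0 fun i => h i + 1) fun j => k j + 1, ?_⟩
    · rintro (i | j) hv
      · cases i using Fin.cases with
        | zero => exact absurd rfl hv
        | succ i => simp [F, completeBipartiteGraph]
      · simp [F, completeBipartiteGraph]
    · rintro (i | j) hv
      · cases i using Fin.cases with
        | zero => exact absurd rfl hv
        | succ i => simpa [F] using ha i
      · rcases hj : b j with i | z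
        · simpa [F, hj] using hb j i hj
        · simp [F, hj]
  · rintro ⟨⟨a, b⟩, h⟩ ⟨⟨a', b'⟩, h'⟩ he
    have he := congrArg Subtype.val he
    refine Subtype.ext (Prod.ext ?_ ?_)
    · funext i
      simpa [F] using congrFun he (.inl i.succ)
    · funext j
      have hj := congrFun he (.inr j)
      rcases h₁ : b j with x | x <;> rcases h₂ : b' j with y | y <;>
        simp_all [F, Fin.succ_ne_zero, (Fin.succ_ne_zero _).symm]
  · rintro ⟨f, hr, hadj, h, hh⟩
    have hleft : ∀ i : Fin n, ∃ j, f (.inl i.succ) = .inr j := fun i => by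
      have := hadj (.inl i.succ) (by simp)
      exact Sum.isRight_iff.1 (by simpa [completeBipartiteGraph] using this)
    have hright : ∀ j : Fin q, ∃ c : Fin n ⊕ Unit,
        f (.inr j) = .inl (c.elim Fin.succ fun _ => 0) := fun j => by
      have := hadj (.inr j) (by simp)
      obtain ⟨i, hi⟩ := Sum.isLeft_iff.1
        (show (f (.inr j)).isLeft by simpa [completeBipartiteGraph] using this)
      cases i using Fin.cases with
      | zero => exact ⟨.inr (), hi⟩
      | succ i => exact ⟨.inl i, hi⟩
    choose a ha using hleft
    choose b hb using hright
    refine ⟨⟨(a, b), fun i => h (.inl i.succ), fun j => h (.inr j), ?_, ?_⟩, Subtype.ext ?_⟩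
    · intro i
      simpa [ha] using hh (.inl i.succ) (by simp)
    · intro j i (hj : b j = .inl i)
      simpa [hb, hj] using hh (.inr j) (by simp)
    · funext v
      rcases v with i | j
      · cases i using Fin.cases with
        | zero => exact hr.symm
        | succ i => simp [F, ha]
      · simp [F, hb]


/-- The number of spanning trees of the complete bipartite graph `K_{p,q}` (`p, q ≥ 1`)
equals `p ^ (q - 1) * q ^ (p - 1)`. -/
theorem card_spanningTrees_completeBipartite (p q : ℕ) (hp : 1 ≤ p) (hq : 1 ≤ q) :
    Nat.card {T : SimpleGraph (Fin p ⊕ Fin q) //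
        T ≤ completeBipartiteGraph (Fin p) (Fin q) ∧ T.IsTree} =
      p ^ (q - 1) * q ^ (p - 1) := by
  obtain ⟨n, rfl⟩ := Nat.exists_eq_succ_of_ne_zero (Nat.one_le_iff_ne_zero.1 hp)
  have : Nonempty (Fin q) := ⟨⟨0, hq⟩⟩
  rw [SimpleGraph.card_spanningTrees_eq_card_parentFunctions _ (.inl 0),
    card_parentFunctions_completeBipartiteGraph, BipartiteForest.card_eq]
  simp [mul_comm]
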